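/- For all n ≥ 1, the number of D-cycles on [2n] equals the Genocchi number g_n, i.e., the number of permutations of [2n] that consist of a single 2n-cycle and satisfy σ(i) ≥ i for all odd i and σ(i) ≤ i for all even i equals the number of Dumont permutations on [2n−2]. -/

import Mathlib

open Finset

/-- The Ferrers graph on vertex set `V ⊆ ℕ`: edges `{u,v}` with `u < v`, `u` odd, `v` even. -/
def ferrers (V : Finset ℕ) : SimpleGraph ℕ :=
  SimpleGraph.fromRel (fun u v => u ∈ V ∧ v ∈ V ∧ u < v ∧ Odd u ∧ Even v)

/-- A partition of `V` is a bond partition if each block induces a connected subgraph. -/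
def IsBond (V : Finset ℕ) (P : Finpartition V) : Prop :=
  ∀ B ∈ P.parts, ((ferrers V).induce (B : Set ℕ)).Connected

/-- `u` is a (strict) descendant of `v` in the graph `G` rooted (componentwise) at `r`. -/
def DescOf {α : Type*} (G : SimpleGraph α) (r v u : α) : Prop :=
  u ≠ v ∧ G.Reachable u r ∧ ∀ p : G.Walk u r, v ∈ p.support

/-- `F` is an increasing-decreasing (ID) forest. -/
def IsIDForest (V : Finset ℕ) (F : SimpleGraph {x // x ∈ V}) : Prop :=
  F.IsAcyclic ∧
  ∀ r v : {x // x ∈ V}, F.Reachable v r → (∀ u, F.Reachable v u → (u : ℕ) ≤ (r : ℕ)) →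
    (Odd (v : ℕ) →
      (∀ u, DescOf F r v u → (v : ℕ) < (u : ℕ)) ∧
      (∀ u, F.Adj v u → DescOf F r v u → Even (u : ℕ))) ∧
    (Even (v : ℕ) →
      (∀ u, DescOf F r v u → (u : ℕ) < (v : ℕ)) ∧
      (∀ u, F.Adj v u → DescOf F r v u → Odd (u : ℕ)))

/-- `T` is an increasing-decreasing (ID) tree. -/
def IsIDTree (V : Finset ℕ) (T : SimpleGraph {x // x ∈ V}) : Prop :=
  T.Connected ∧ IsIDForest V T

/-- A D-permutation on `A`. -/
def IsDPerm (A : Finset ℕ) (σ : Equiv.Perm {x // x ∈ A}) : Prop :=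
  ∀ i : {x // x ∈ A}, (Odd (i : ℕ) → (i : ℕ) ≤ (σ i : ℕ)) ∧ (Even (i : ℕ) → (σ i : ℕ) ≤ (i : ℕ))

/-- A D-cycle on `A`: a D-permutation which is a single cycle covering `A`. -/
def IsDCycle (A : Finset ℕ) (σ : Equiv.Perm {x // x ∈ A}) : Prop :=
  IsDPerm A σ ∧ ∀ x y : {x // x ∈ A}, σ.SameCycle x y

/-- The number of cycles (orbits, fixed points included) of a permutation. -/
noncomputable def cycleCount {α : Type*} (σ : Equiv.Perm α) : ℕ :=
  Nat.card (Quotient (⟨σ.SameCycle, Equiv.Perm.SameCycle.equivalence σ⟩ : Setoid α))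

/-- A Dumont permutation on `A` (intended for `A = [2m]`). -/
def IsDumontPerm (A : Finset ℕ) (σ : Equiv.Perm {x // x ∈ A}) : Prop :=
  ∀ i : {x // x ∈ A}, (Even (i : ℕ) → (σ i : ℕ) < (i : ℕ)) ∧ (Odd (i : ℕ) → (i : ℕ) ≤ (σ i : ℕ))

/-- A Dumont derangement on `A` (intended for `A = [2m]`). -/
def IsDumontDerangement (A : Finset ℕ) (σ : Equiv.Perm {x // x ∈ A}) : Prop :=
  ∀ i : {x // x ∈ A}, (Even (i : ℕ) → (σ i : ℕ) < (i : ℕ)) ∧ (Odd (i : ℕ) → (i : ℕ) < (σ i : ℕ))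

/-- The Genocchi number `g n`: the number of Dumont permutations on `[2n-2]`. -/
noncomputable def genocchi (n : ℕ) : ℕ :=
  Nat.card {σ : Equiv.Perm {x // x ∈ Finset.Icc 1 (2 * n - 2)} // IsDumontPerm _ σ}

/-- The median Genocchi number `h n`: the number of Dumont derangements on `[2n+2]`. -/
noncomputable def medianGenocchi (n : ℕ) : ℕ :=
  Nat.card {σ : Equiv.Perm {x // x ∈ Finset.Icc 1 (2 * n + 2)} // IsDumontDerangement _ σ}

open Equiv

theorem Equiv.Perm.SameCycle.of_step {α β : Type*} {e : Perm α} {τ : Perm β} {f : α → β}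
    (h : ∀ a, τ.SameCycle (f a) (f (e a))) {a b : α} (hab : e.SameCycle a b) :
    τ.SameCycle (f a) (f b) := by
  obtain ⟨k, rfl⟩ := hab
  induction k using Int.induction_on with
  | zero => exact Perm.SameCycle.refl _ _
  | succ k ih =>
    refine ih.trans ?_
    have := h ((e ^ (k : ℤ)) a)
    rwa [← Perm.mul_apply, ← zpow_one_add, add_comm] at this
  | pred k ih =>
    refine ih.trans (Perm.SameCycle.symm ?_)
    have := h ((e ^ (-(k : ℤ) - 1)) a)
    rwa [← Perm.mul_apply, ← zpow_one_add, add_sub_cancel] at this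

/-- Permutations of `Fin (n + 1)` are obtained by inserting `0` right after an element `p` in the
cycle structure of a permutation of `{1, …, n}` (as a fixed point if `p = 0`). -/
def insertZero (n : ℕ) : Perm (Fin (n + 1)) ≃ Fin (n + 1) × Perm (Fin n) :=
  (Equiv.inv _).trans (Perm.decomposeFin.trans ((Equiv.refl _).prodCongr (Equiv.inv _)))

theorem insertZero_symm_apply {n : ℕ} (p : Fin (n + 1)) (e : Perm (Fin n)) (x : Fin (n + 1)) :
    (insertZero n).symm (p, e) x =
      (Fin.cases 0 (fun j => (e j).succ) (swap 0 p x) : Fin (n + 1)) := by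
  have h : (insertZero n).symm (p, e) = (Perm.decomposeFin.symm (p, e⁻¹))⁻¹ := rfl
  rw [h, Perm.inv_eq_iff_eq]
  have h2 : ∀ y : Fin (n + 1), Perm.decomposeFin.symm (p, e⁻¹)
      (Fin.cases 0 (fun j => (e j).succ) y) = swap 0 p y := by
    intro y
    cases y using Fin.cases <;> simp
  rw [h2, swap_apply_self]

theorem insertZero_symm_self {n : ℕ} (p : Fin (n + 1)) (e : Perm (Fin n)) :
    (insertZero n).symm (p, e) p = 0 := by
  simp [insertZero_symm_apply]

theorem insertZero_symm_zero_succ {n : ℕ} (q : Fin n) (e : Perm (Fin n)) :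
    (insertZero n).symm (q.succ, e) 0 = (e q).succ := by
  simp [insertZero_symm_apply]

theorem insertZero_symm_succ {n : ℕ} {p : Fin (n + 1)} (e : Perm (Fin n)) {i : Fin n}
    (h : i.succ ≠ p) : (insertZero n).symm (p, e) i.succ = (e i).succ := by
  rw [insertZero_symm_apply, swap_apply_of_ne_of_ne (Fin.succ_ne_zero _) h]
  simp

theorem insertZero_symm_lt_iff {n : ℕ} (p : Fin (n + 1)) (e : Perm (Fin n)) (i : Fin n) :
    (insertZero n).symm (p, e) i.succ < i.succ ↔ i.succ = p ∨ e i < i := by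
  by_cases h : i.succ = p
  · subst h
    simp [insertZero_symm_self]
  · simp [insertZero_symm_succ e h, h]

theorem insertZero_symm_sameCycle_iff {n : ℕ} (p : Fin (n + 2)) (e : Perm (Fin (n + 1))) :
    (∀ x y, ((insertZero (n + 1)).symm (p, e)).SameCycle x y) ↔
      p ≠ 0 ∧ ∀ x y, e.SameCycle x y := by
  set τ := (insertZero (n + 1)).symm (p, e) with hτ
  cases p using Fin.cases with
  | zero =>
    refine iff_of_false (fun h => ?_) (by simp)
    have h0 : Function.IsFixedPt τ 0 := insertZero_symm_self _ _
    exact Fin.succ_ne_zero (0 : Fin (n + 1)) ((h 0 _).eq_of_left h0).symm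
  | succ q =>
    simp only [ne_eq, Fin.succ_ne_zero, not_false_eq_true, true_and]
    have hq : τ q.succ = 0 := insertZero_symm_self _ _
    have h0 : τ 0 = (e q).succ := insertZero_symm_zero_succ _ _
    have hs : ∀ a, a ≠ q → τ a.succ = (e a).succ := fun a ha =>
      insertZero_symm_succ e (by simpa using ha)
    constructor
    · intro h x y
      have step : ∀ a, e.SameCycle ((Fin.cases q id a : Fin (n + 1)))
          ((Fin.cases q id (τ a) : Fin (n + 1))) := by
        intro a
        cases a using Fin.cases with
        | zero => rw [h0]; exact ⟨1, by simp⟩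
        | succ a =>
          by_cases ha : a = q
          · subst ha; rw [hq]; exact ⟨0, by simp⟩
          · rw [hs a ha]; exact ⟨1, by simp⟩
      simpa using Perm.SameCycle.of_step step (h x.succ y.succ)
    · intro h
      have step : ∀ a, τ.SameCycle a.succ (e a).succ := by
        intro a
        by_cases ha : a = q
        · subst ha
          exact ⟨2, by rw [zpow_ofNat, pow_two, Perm.mul_apply, hq, h0]⟩
        · exact ⟨1, by rw [zpow_one, hs a ha]⟩
      have key : ∀ x, τ.SameCycle q.succ x := by
        intro x
        cases x using Fin.cases with
        | zero => exact ⟨1, by rw [zpow_one, hq]⟩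
        | succ x => exact Perm.SameCycle.of_step step (h q x)
      exact fun x y => (key x).symm.trans (key y)

/-- A form of Foata's fundamental transformation: permutations of `Fin n` correspond to full cycles
of `Fin (n + 1)` with the same strict anti-excedances among the first `n` elements. -/
theorem exists_perm_equiv_fullCycle (n : ℕ) :
    ∃ Φ : Perm (Fin n) ≃ {σ : Perm (Fin (n + 1)) // ∀ x y, σ.SameCycle x y},
      ∀ π i, (Φ π).1 (Fin.castSucc i) < Fin.castSucc i ↔ π i < i := by
  induction n with
  | zero =>
    have : Unique {σ : Perm (Fin 1) // ∀ x y, σ.SameCycle x y} :=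
      { default := ⟨1, fun x y => ⟨0, Subsingleton.elim _ _⟩⟩
        uniq := fun _ => Subsingleton.elim _ _ }
    exact ⟨Equiv.ofUnique _ _, fun _ i => i.elim0⟩
  | succ n ih =>
    obtain ⟨Φ, hΦ⟩ := ih
    let F : Fin (n + 1) × {σ : Perm (Fin (n + 1)) // ∀ x y, σ.SameCycle x y} →
        {σ : Perm (Fin (n + 2)) // ∀ x y, σ.SameCycle x y} := fun z =>
      ⟨(insertZero (n + 1)).symm (((finRotate (n + 1)).symm z.1).succ, z.2.1),
        (insertZero_symm_sameCycle_iff _ _).2 ⟨Fin.succ_ne_zero _, z.2.2⟩⟩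
    have hF : Function.Bijective F := by
      constructor
      · rintro ⟨p, e⟩ ⟨p', e'⟩ h
        have := (insertZero (n + 1)).symm.injective (congrArg Subtype.val h)
        simp only [Prod.mk.injEq, Fin.succ_inj, EmbeddingLike.apply_eq_iff_eq] at this
        exact Prod.ext this.1 (Subtype.ext this.2)
      · rintro ⟨σ, hσ⟩
        obtain ⟨⟨p, e⟩, rfl⟩ := (insertZero (n + 1)).symm.surjective σ
        obtain ⟨hp, he⟩ := (insertZero_symm_sameCycle_iff _ _).1 hσ
        obtain ⟨q, rfl⟩ := Fin.exists_succ_eq.2 hp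
        exact ⟨(finRotate (n + 1) q, ⟨e, he⟩), Subtype.ext (by simp [F])⟩
    refine ⟨(insertZero n).trans (((Equiv.refl _).prodCongr Φ).trans (Equiv.ofBijective F hF)), ?_⟩
    intro π i
    obtain ⟨⟨p, e⟩, rfl⟩ := (insertZero n).symm.surjective π
    simp only [Equiv.trans_apply, Equiv.apply_symm_apply, Equiv.prodCongr_apply, Prod.map,
      Equiv.refl_apply, Equiv.ofBijective_apply, F]
    cases i using Fin.cases with
    | zero => simp
    | succ i =>
      rw [← Fin.succ_castSucc, insertZero_symm_lt_iff, insertZero_symm_lt_iff, hΦ,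
        Fin.succ_inj, Equiv.eq_symm_apply, finRotate_apply, Fin.coeSucc_eq_succ]

/-- The bijection `i ↦ i + 1` between `Fin k` and `{1, …, k}`. -/
def finEquivIcc (k : ℕ) : Fin k ≃ {x // x ∈ Finset.Icc 1 k} where
  toFun i := ⟨i + 1, by simp⟩
  invFun x := ⟨x - 1, by have := Finset.mem_Icc.1 x.2; omega⟩
  left_inv i := by simp
  right_inv x := by
    have := Finset.mem_Icc.1 x.2
    ext
    simp
    omega

theorem isDCycle_permCongr_iff (m : ℕ) (σ : Perm (Fin (2 * m + 2))) :
    IsDCycle (Finset.Icc 1 (2 * m + 2)) ((finEquivIcc _).permCongr σ) ↔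
      (∀ x y, σ.SameCycle x y) ∧
        ∀ i : Fin (2 * m + 1), σ i.castSucc < i.castSucc ↔ Odd (i : ℕ) := by
  have hcyc : (∀ x y, ((finEquivIcc (2 * m + 2)).permCongr σ).SameCycle x y) ↔
      ∀ x y, σ.SameCycle x y := by
    constructor
    · intro h x y
      have := h (finEquivIcc _ x) (finEquivIcc _ y)
      have := Perm.SameCycle.of_step (τ := σ) (f := (finEquivIcc _).symm)
        (fun a => ⟨1, by simp⟩) this
      simpa using this
    · intro h x y
      have := Perm.SameCycle.of_step (τ := (finEquivIcc _).permCongr σ) (f := finEquivIcc _)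
        (fun a => ⟨1, by simp⟩) (h ((finEquivIcc _).symm x) ((finEquivIcc _).symm y))
      simpa using this
  rw [IsDCycle, hcyc, and_comm]
  refine and_congr_right fun h => ?_
  have hne : ∀ i, (σ i : ℕ) ≠ i := by
    intro i hi
    have hfix : Function.IsFixedPt σ i := Fin.ext hi
    have h0 := (h i 0).eq_of_left hfix
    have h1 := (h i (Fin.last _)).eq_of_left hfix
    have := congrArg Fin.val (h0.symm.trans h1)
    simp at this
  have hD : IsDPerm (Finset.Icc 1 (2 * m + 2)) ((finEquivIcc _).permCongr σ) ↔
      ∀ i : Fin (2 * m + 2), σ i < i ↔ Odd (i : ℕ) := by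
    rw [IsDPerm, ← (finEquivIcc (2 * m + 2)).forall_congr_right]
    refine forall_congr' fun i => ?_
    have := hne i
    simp only [Equiv.permCongr_apply, Equiv.symm_apply_apply, Fin.lt_def]
    simp only [finEquivIcc, Equiv.coe_fn_mk, Nat.odd_iff, Nat.even_iff]
    omega
  rw [hD, Fin.forall_fin_succ']
  refine and_iff_left ?_
  have h1 := hne (Fin.last _)
  have h2 := (σ (Fin.last _)).isLt
  simp only [Fin.lt_def, Fin.val_last, Nat.odd_iff] at *
  omega

/-- The bijection `x ↦ x - 1` from `{1, …, k}` onto the non-maximal elements of `Fin (k + 1)`. -/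
def iccEquivFinSubtype (k : ℕ) : {x // x ∈ Finset.Icc 1 k} ≃ {i : Fin (k + 1) // (i : ℕ) < k} :=
  (finEquivIcc k).symm.trans
    { toFun := fun i => ⟨i.castSucc, i.2⟩
      invFun := fun i => ⟨i.1, i.2⟩
      left_inv := fun _ => rfl
      right_inv := fun _ => rfl }

theorem card_dumont_eq (m : ℕ) :
    Nat.card {π : Perm (Fin (2 * m + 1)) // ∀ i, π i < i ↔ Odd (i : ℕ)} =
      Nat.card {σ : Perm {x // x ∈ Finset.Icc 1 (2 * m)} // IsDumontPerm _ σ} := by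
  let p : Fin (2 * m + 1) → Prop := fun i => (i : ℕ) < 2 * m
  have e1 : {π : Perm (Fin (2 * m + 1)) // ∀ i, π i < i ↔ Odd (i : ℕ)} ≃
      {f : {f : Perm (Fin (2 * m + 1)) // ∀ a, ¬ p a → f a = a} //
        ∀ i, f.1 i < i ↔ Odd (i : ℕ)} := by
    refine (Equiv.subtypeSubtypeEquivSubtype (q := fun π : Perm (Fin (2 * m + 1)) =>
      ∀ i, π i < i ↔ Odd (i : ℕ)) ?_).symm
    intro π h a ha
    have h1 := h a
    have h2 := (π a).isLt
    have h3 := a.isLt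
    simp only [p] at ha
    simp only [Fin.lt_def, Nat.odd_iff] at h1
    ext
    omega
  refine (Nat.card_congr e1).trans (Nat.card_congr (Equiv.subtypeEquiv
    (((iccEquivFinSubtype (2 * m)).permCongr.trans
      (Perm.subtypeEquivSubtypePerm p))) ?_).symm)
  intro σ
  rw [IsDumontPerm, ← ((finEquivIcc (2 * m))).forall_congr_right, Fin.forall_fin_succ']
  have hlast : (Perm.ofSubtype ((iccEquivFinSubtype (2 * m)).permCongr σ) : Perm _)
      (Fin.last (2 * m)) = Fin.last (2 * m) :=
    Perm.ofSubtype_apply_of_not_mem _ (by simp)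
  simp only [Equiv.trans_apply, Perm.subtypeEquivSubtypePerm_apply_coe]
  refine Iff.trans ?_ (and_iff_left ?_).symm
  · refine forall_congr' fun i => ?_
    have hi : (Perm.ofSubtype ((iccEquivFinSubtype (2 * m)).permCongr σ) : Perm _)
        i.castSucc = ((iccEquivFinSubtype (2 * m)) (σ (finEquivIcc (2 * m) i))).1 := by
      rw [Perm.ofSubtype_apply_of_mem _ (by simp)]
      rfl
    have h1 := Finset.mem_Icc.1 (σ (finEquivIcc (2 * m) i)).2
    have h2 : ((iccEquivFinSubtype (2 * m) (σ (finEquivIcc (2 * m) i))).1 : ℕ) =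
      (σ (finEquivIcc (2 * m) i) : ℕ) - 1 := rfl
    have h3 : (finEquivIcc (2 * m) i : ℕ) = i + 1 := rfl
    rw [hi, Fin.lt_def, h2, h3]
    simp only [Nat.odd_iff, Nat.even_iff, Fin.val_castSucc]
    omega
  · rw [hlast]
    simp

/-- The number of D-cycles on `[2n]` is the Genocchi number `g_n`,
the number of Dumont permutations on `[2n-2]`. -/
theorem stmt5 (n : ℕ) (hn : 1 ≤ n) :
    Nat.card {σ : Equiv.Perm {x // x ∈ Finset.Icc 1 (2 * n)} //
        IsDCycle (Finset.Icc 1 (2 * n)) σ} = genocchi n := by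
  obtain ⟨m, rfl⟩ : ∃ m, n = m + 1 := ⟨n - 1, by omega⟩
  obtain ⟨Φ, hΦ⟩ := exists_perm_equiv_fullCycle (2 * m + 1)
  refine Eq.trans ?_ (card_dumont_eq m)
  refine (Nat.card_congr (Equiv.subtypeEquiv (finEquivIcc (2 * m + 2)).permCongr
    fun σ => (isDCycle_permCongr_iff m σ).symm)).symm.trans ?_
  refine (Nat.card_congr ((Equiv.subtypeSubtypeEquivSubtypeInter
    (fun σ : Perm (Fin (2 * m + 2)) => ∀ x y, σ.SameCycle x y)
    (fun σ => ∀ i : Fin (2 * m + 1), σ i.castSucc < i.castSucc ↔ Odd (i : ℕ))).symm.trans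
    (Equiv.subtypeEquiv Φ fun π => ?_).symm))
  exact forall_congr' fun i => by rw [hΦ]
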